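/- Let 0 < p < 1 and let (Φ_n)_{n≥1} be any nondecreasing sequence of positive reals with lim_{n→∞} Φ_n = +∞. Then there exists a martingale f ∈ H_p(G_m) such that Σ_{k=1}^∞ ‖S_k f‖_{L_{p,∞}}^p Φ_k / k^{2−p} = ∞. -/

import Mathlib

open MeasureTheory Filter Finset
open scoped Classical ENNReal NNReal

noncomputable section

namespace VilenkinPaper

/-- The generalized powers `M_0 = 1`, `M_{k+1} = m_k M_k`. -/
def Mseq (m : ℕ → ℕ) : ℕ → ℕ
  | 0 => 1
  | k + 1 => m k * Mseq m k

/-- The Vilenkin group `G_m = ∏_k ℤ_{m_k}`. -/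
abbrev Gm (m : ℕ → ℕ) : Type := (k : ℕ) → ZMod (m k)

/-- The `j`-th digit of `n` in the generalized number system based on `m`. -/
def digit (m : ℕ → ℕ) (n j : ℕ) : ℕ := n / Mseq m j % m j

/-- The generalized Rademacher functions `r_k(x) = exp(2πi x_k / m_k)`. -/
def rad (m : ℕ → ℕ) (k : ℕ) (x : Gm m) : ℂ :=
  Complex.exp (2 * Real.pi * Complex.I * ((x k).val : ℂ) / (m k : ℂ))

/-- The Vilenkin system `ψ_n = ∏_k r_k^{n_k}`. -/
def psi (m : ℕ → ℕ) (n : ℕ) (x : Gm m) : ℂ := ∏ᶠ k : ℕ, rad m k x ^ digit m n k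

/-- The Dirichlet kernels `D_n = ∑_{k<n} ψ_k`. -/
def Dker (m : ℕ → ℕ) (n : ℕ) (x : Gm m) : ℂ := ∑ k ∈ Finset.range n, psi m k x

/-- The interval `I_n(x)` : all `y` agreeing with `x` on the first `n` coordinates. -/
def Iset (m : ℕ → ℕ) (n : ℕ) (x : Gm m) : Set (Gm m) := {y | ∀ k < n, y k = x k}

/-- `I_n := I_n(0)`. -/
def IsetO (m : ℕ → ℕ) (n : ℕ) : Set (Gm m) := Iset m n 0

/-- `μ` is the normalized Haar (product) measure iff every interval `I_n(x)` has
measure `1 / M_n`. -/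
def IsHaarGm (m : ℕ → ℕ) (μ : Measure (Gm m)) : Prop :=
  ∀ n x, μ (Iset m n x) = ((Mseq m n : ℝ≥0∞))⁻¹

/-- The σ-algebra `F_n` generated by the intervals `{I_n(x)}`, i.e. by the first `n`
coordinates. -/
def filt (m : ℕ → ℕ) (n : ℕ) : MeasurableSpace (Gm m) :=
  MeasurableSpace.comap (fun x (k : Fin n) => x k) ⊤

/-- A (Vilenkin) martingale with respect to the filtration `F_n`. -/
def IsVMartingale (m : ℕ → ℕ) (μ : Measure (Gm m)) (f : ℕ → Gm m → ℂ) : Prop :=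
  (∀ n, Integrable (f n) μ) ∧
  (∀ n, Measurable[filt m n] (f n)) ∧
  (∀ n N, n ≤ N → μ[f N | filt m n] =ᵐ[μ] f n)

/-- Membership in the martingale Hardy space `H_p`: the maximal function
`f* = sup_n |f^{(n)}|` belongs to `L_p`. -/
def MemHp (m : ℕ → ℕ) (μ : Measure (Gm m)) (p : ℝ) (f : ℕ → Gm m → ℂ) : Prop :=
  ∫⁻ x, (⨆ n, (‖f n x‖₊ : ℝ≥0∞)) ^ p ∂μ < ⊤

/-- The `i`-th Vilenkin–Fourier coefficient of an integrable function. -/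
def fourierCoefFn (m : ℕ → ℕ) (μ : Measure (Gm m)) (g : Gm m → ℂ) (i : ℕ) : ℂ :=
  ∫ x, g x * (starRingEnd ℂ) (psi m i x) ∂μ

/-- The partial sum `S_n` built from a sequence `c` of Fourier coefficients. -/
def Spart (m : ℕ → ℕ) (c : ℕ → ℂ) (n : ℕ) (x : Gm m) : ℂ :=
  ∑ k ∈ Finset.range n, c k * psi m k x

/-- The weak `L_{p,∞}` quasinorm `sup_{λ>0} λ μ(|g| > λ)^{1/p}`. -/
def wLp (m : ℕ → ℕ) (μ : Measure (Gm m)) (p : ℝ) (g : Gm m → ℂ) : ℝ≥0∞ :=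
  ⨆ (t : ℝ) (_ : 0 < t), ENNReal.ofReal t * μ {x | t < ‖g x‖} ^ (1 / p)

/-- `|n| = max {j : n_j ≠ 0}`. -/
def maxDigit (m : ℕ → ℕ) (n : ℕ) : ℕ := sSup {j | digit m n j ≠ 0}

/-- The set `ℕ_{n_0}` of positive integers with `n_0 = n_{|n|} = 1`. -/
def Nn0 (m : ℕ → ℕ) : Set ℕ :=
  {n | 0 < n ∧ digit m n 0 = 1 ∧ digit m n (maxDigit m n) = 1}

/-- The atom `a = (M_α^{1/p-1}/M) (D_{M_{α+1}} - D_{M_α})`. -/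
def atomFun (m : ℕ → ℕ) (MM : ℕ) (p : ℝ) (a : ℕ) (x : Gm m) : ℂ :=
  (((Mseq m a : ℝ) ^ (1 / p - 1) / (MM : ℝ) : ℝ) : ℂ) *
    (Dker m (Mseq m (a + 1)) x - Dker m (Mseq m a) x)

/-- The coefficients `λ_k = Φ_{M_{α_k}}^{-1/4}`. -/
def lamSeq (m : ℕ → ℕ) (Φ : ℕ → ℝ) (α : ℕ → ℕ) (k : ℕ) : ℝ :=
  Φ (Mseq m (α k)) ^ (-(1 / 4 : ℝ))

/-- The martingale `f^{(A)} = ∑_{k : α_k < A} λ_k a_k` of the counterexample construction. -/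
def fCon (m : ℕ → ℕ) (MM : ℕ) (p : ℝ) (Φ : ℕ → ℝ) (α : ℕ → ℕ) (A : ℕ) (x : Gm m) : ℂ :=
  ∑ᶠ (k : ℕ) (_ : α k < A), (lamSeq m Φ α k : ℂ) * atomFun m MM p (α k) x

section NumberSystem

variable {m : ℕ → ℕ}

lemma Mseq_pos (hm : ∀ k, 2 ≤ m k) (n : ℕ) : 0 < Mseq m n := by
  induction n with
  | zero => simp [Mseq]
  | succ n ih => exact Nat.mul_pos (by have := hm n; omega) ih

lemma two_mul_Mseq_le (hm : ∀ k, 2 ≤ m k) (n : ℕ) : 2 * Mseq m n ≤ Mseq m (n + 1) :=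
  Nat.mul_le_mul_right _ (hm n)

lemma Mseq_strictMono (hm : ∀ k, 2 ≤ m k) : StrictMono (Mseq m) :=
  strictMono_nat_of_lt_succ fun n => by
    have := two_mul_Mseq_le hm n
    have := Mseq_pos hm n
    omega

lemma Mseq_dvd {a b : ℕ} (h : a ≤ b) : Mseq m a ∣ Mseq m b := by
  induction b, h using Nat.le_induction with
  | base => exact dvd_rfl
  | succ b _ ih => exact ih.mul_left _

lemma Mseq_one : Mseq m 1 = m 0 := by simp [Mseq]

lemma base_dvd_Mseq_succ (a : ℕ) : m 0 ∣ Mseq m (a + 1) := by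
  rw [← Mseq_one (m := m)]
  exact Mseq_dvd (by omega)

lemma digit_eq_mod_div (n k : ℕ) : digit m n k = n % Mseq m (k + 1) / Mseq m k := by
  rw [digit, Mseq, mul_comm, Nat.mod_mul_right_div_self]

lemma digit_eq_zero_of_lt {n k : ℕ} (h : n < Mseq m k) : digit m n k = 0 := by
  rw [digit, Nat.div_eq_of_lt h, Nat.zero_mod]

lemma digit_Mseq_mul_add_of_lt {a k : ℕ} (h : k < a) (l r : ℕ) :
    digit m (Mseq m a * l + r) k = digit m r k := by
  obtain ⟨c, hc⟩ := Mseq_dvd (m := m) (show k + 1 ≤ a from h)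
  rw [digit_eq_mod_div, digit_eq_mod_div, hc, mul_assoc, Nat.mul_add_mod]

lemma digit_Mseq_mul_add_self (hm : ∀ k, 2 ≤ m k) {a l r : ℕ} (hl : l < m a)
    (hr : r < Mseq m a) : digit m (Mseq m a * l + r) a = l := by
  rw [digit, Nat.mul_add_div (Mseq_pos hm a), Nat.div_eq_of_lt hr, add_zero, Nat.mod_eq_of_lt hl]

lemma digit_base_mul_add_succ (q k : ℕ) {l : ℕ} (hl : l < m 0) :
    digit m (m 0 * q + l) (k + 1) = digit m (m 0 * q) (k + 1) := by
  obtain ⟨c, hc⟩ := base_dvd_Mseq_succ (m := m) k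
  have h0 : 0 < m 0 := by omega
  rw [digit, digit, hc, ← Nat.div_div_eq_div_mul, ← Nat.div_div_eq_div_mul, Nat.mul_add_div h0,
    Nat.div_eq_of_lt hl, add_zero, Nat.mul_div_cancel_left _ h0]

lemma digit_base_mul_add_zero (q : ℕ) {l : ℕ} (hl : l < m 0) :
    digit m (m 0 * q + l) 0 = l := by
  simp [digit, Mseq, Nat.mod_eq_of_lt hl]

/-- If two numbers have the same digits, they are equal. -/
lemma eq_of_digit_eq (hm : ∀ k, 2 ≤ m k) {i j : ℕ} (h : ∀ k, digit m i k = digit m j k) :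
    i = j := by
  have key : ∀ K, i % Mseq m K = j % Mseq m K := by
    intro K
    induction K with
    | zero => simp [Mseq, Nat.mod_one]
    | succ K ih =>
      rw [Mseq, mul_comm, Nat.mod_mul, Nat.mod_mul, ih]
      have := h K
      simp only [digit] at this
      rw [this]
  have hK := (Mseq_strictMono hm).le_apply (x := i + j + 1)
  have := key (i + j + 1)
  rwa [Nat.mod_eq_of_lt (by omega), Nat.mod_eq_of_lt (by omega)] at this

lemma exists_digit_ne_zero (hm : ∀ k, 2 ≤ m k) {n i : ℕ} (h : Mseq m n ≤ i) :
    ∃ b, n ≤ b ∧ digit m i b ≠ 0 := by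
  by_contra! hcon
  have : i % Mseq m n = i := by
    apply eq_of_digit_eq hm
    intro k
    rcases lt_or_ge k n with hk | hk
    · conv_rhs => rw [← Nat.div_add_mod i (Mseq m n)]
      rw [digit_Mseq_mul_add_of_lt hk]
    · rw [hcon k hk, digit_eq_zero_of_lt]
      exact (Nat.mod_lt _ (Mseq_pos hm n)).trans_le ((Mseq_strictMono hm).monotone hk)
  have := Nat.mod_lt i (Mseq_pos hm n)
  omega

/-- The index `a` with `M_a ≤ n < M_{a+1}`, and `0` for `n = 0`. -/
def level (m : ℕ → ℕ) (n : ℕ) : ℕ := sInf {a | n < Mseq m (a + 1)}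

lemma level_eq (hm : ∀ k, 2 ≤ m k) {a n : ℕ} (h1 : Mseq m a ≤ n) (h2 : n < Mseq m (a + 1)) :
    level m n = a := by
  refine le_antisymm (Nat.sInf_le h2) (le_csInf ⟨a, h2⟩ fun b hb => ?_)
  by_contra! hlt
  have := (Mseq_strictMono hm).monotone (show b + 1 ≤ a from hlt)
  have : n < Mseq m (b + 1) := hb
  omega

lemma level_zero (hm : ∀ k, 2 ≤ m k) : level m 0 = 0 :=
  Nat.le_zero.1 (Nat.sInf_le (Mseq_pos hm 1))

lemma level_base_mul_add (q : ℕ) {l : ℕ} (hl : l < m 0) :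
    level m (m 0 * q + l) = level m (m 0 * q) := by
  unfold level
  congr 1
  ext a
  obtain ⟨c, hc⟩ := base_dvd_Mseq_succ (m := m) a
  simp only [Set.mem_ofPred_eq, hc]
  refine ⟨fun h => by omega, fun h => ?_⟩
  have h1 : q + 1 ≤ c := Nat.lt_of_mul_lt_mul_left h
  have := Nat.mul_le_mul_left (m 0) h1
  rw [mul_add] at this
  omega

lemma sum_range_mul_eq {E : Type*} [AddCommMonoid E] (f : ℕ → E) (a b : ℕ) :
    ∑ i ∈ range (b * a), f i = ∑ l ∈ range b, ∑ r ∈ range a, f (a * l + r) := by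
  induction b with
  | zero => simp
  | succ b ih => rw [add_mul, one_mul, sum_range_add, ih, sum_range_succ, mul_comm b a]

lemma tsum_le_tsum_of_le_sum_Ico (hm : ∀ k, 2 ≤ m k) {T g : ℕ → ℝ≥0∞}
    (h : ∀ a, g a ≤ ∑ k ∈ Ico (Mseq m (a + 1)) (Mseq m (a + 2)), T k) :
    ∑' a, g a ≤ ∑' k, T k := by
  have hmono := (Mseq_strictMono hm).monotone
  have key : ∀ n, ∑ a ∈ range n, g a ≤ ∑ k ∈ range (Mseq m (n + 1)), T k := by
    intro n
    induction n with
    | zero => simp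
    | succ n ih =>
      rw [sum_range_succ, ← sum_range_add_sum_Ico T (hmono (show n + 1 ≤ n + 2 by omega))]
      exact add_le_add ih (h n)
  exact ENNReal.tsum_le_of_sum_range_le fun n => (key n).trans (ENNReal.sum_le_tsum _)

end NumberSystem

section Characters

variable {m : ℕ → ℕ}

lemma psi_eq_prod (hm : ∀ k, 2 ≤ m k) {n K : ℕ} (h : n < Mseq m K) (x : Gm m) :
    psi m n x = ∏ k ∈ range K, rad m k x ^ digit m n k := by
  refine finprod_eq_prod_of_mulSupport_subset _ fun k hk => ?_
  by_contra hK
  simp only [coe_range, Set.mem_Iio, not_lt] at hK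
  refine hk ?_
  simp only [digit_eq_zero_of_lt (h.trans_le ((Mseq_strictMono hm).monotone hK)), pow_zero]

lemma lt_Mseq_succ_self (hm : ∀ k, 2 ≤ m k) (n : ℕ) : n < Mseq m (n + 1) :=
  (Nat.lt_succ_self n).trans_le ((Mseq_strictMono hm).le_apply)

lemma Spart_level_Mseq_succ (hm : ∀ k, 2 ≤ m k) (κ : ℕ → ℂ) (n : ℕ) (x : Gm m) :
    Spart m (fun i => κ (level m i)) (Mseq m (n + 1)) x =
      Spart m (fun i => κ (level m i)) (Mseq m n) x +
        κ n * ∑ i ∈ Ico (Mseq m n) (Mseq m (n + 1)), psi m i x := by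
  rw [Spart, Spart, ← sum_range_add_sum_Ico _ ((Mseq_strictMono hm).monotone n.le_succ), mul_sum]
  congr 1
  refine sum_congr rfl fun i hi => ?_
  rw [level_eq hm (mem_Ico.1 hi).1 (mem_Ico.1 hi).2]

lemma psi_Mseq_mul_add (hm : ∀ k, 2 ≤ m k) {a l r : ℕ} (hl : l < m a) (hr : r < Mseq m a)
    (x : Gm m) : psi m (Mseq m a * l + r) x = rad m a x ^ l * psi m r x := by
  have hlt : Mseq m a * l + r < Mseq m (a + 1) := by
    have := Nat.mul_le_mul_left (Mseq m a) (show l + 1 ≤ m a from hl)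
    rw [mul_add] at this
    rw [Mseq, mul_comm (m a)]
    omega
  rw [psi_eq_prod hm hlt, psi_eq_prod hm hr, prod_range_succ, digit_Mseq_mul_add_self hm hl hr,
    mul_comm]
  congr 1
  refine prod_congr rfl fun k hk => ?_
  rw [digit_Mseq_mul_add_of_lt (mem_range.1 hk)]

lemma psi_base_mul_add (hm : ∀ k, 2 ≤ m k) (q : ℕ) {l : ℕ} (hl : l < m 0) (x : Gm m) :
    psi m (m 0 * q + l) x = psi m (m 0 * q) x * rad m 0 x ^ l := by
  have h := lt_Mseq_succ_self hm (m 0 * q + l)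
  have h0 := digit_base_mul_add_zero (m := m) q (show 0 < m 0 by omega)
  rw [add_zero] at h0
  rw [psi_eq_prod hm h, psi_eq_prod hm (show m 0 * q < Mseq m (m 0 * q + l + 1) by omega),
    prod_range_succ', prod_range_succ', digit_base_mul_add_zero q hl, h0, pow_zero, mul_one]
  congr 1
  refine prod_congr rfl fun k _ => ?_
  rw [digit_base_mul_add_succ q k hl]

lemma Dker_Mseq_succ (hm : ∀ k, 2 ≤ m k) (a : ℕ) (x : Gm m) :
    Dker m (Mseq m (a + 1)) x = (∑ l ∈ range (m a), rad m a x ^ l) * Dker m (Mseq m a) x := by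
  rw [Dker, Dker, Mseq, sum_range_mul_eq, sum_mul]
  refine sum_congr rfl fun l hl => ?_
  rw [mul_sum]
  exact sum_congr rfl fun r hr => psi_Mseq_mul_add hm (mem_range.1 hl) (mem_range.1 hr) x

variable [∀ k, NeZero (m k)]

lemma rad_eq_stdAddChar (k : ℕ) (x : Gm m) : rad m k x = ZMod.stdAddChar (x k) := by
  rw [ZMod.stdAddChar_apply, ZMod.toCircle_apply, rad]

lemma norm_rad (k : ℕ) (x : Gm m) : ‖rad m k x‖ = 1 := by
  rw [rad_eq_stdAddChar, ZMod.stdAddChar_apply, Circle.norm_coe]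

lemma rad_pow_base (k : ℕ) (x : Gm m) : rad m k x ^ m k = 1 := by
  rw [rad_eq_stdAddChar, ← AddChar.map_nsmul_eq_pow]
  simp

lemma rad_ne_one {k : ℕ} {x : Gm m} (h : x k ≠ 0) : rad m k x ≠ 1 := by
  rw [rad_eq_stdAddChar, ← AddChar.map_zero_eq_one (ZMod.stdAddChar (N := m k))]
  exact fun h' => h (ZMod.injective_stdAddChar h')

lemma sum_rad_pow_eq_zero {k : ℕ} {x : Gm m} (h : x k ≠ 0) :
    ∑ l ∈ range (m k), rad m k x ^ l = 0 := by
  rw [geom_sum_eq (rad_ne_one h), rad_pow_base, sub_self, zero_div]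

lemma norm_psi (hm : ∀ k, 2 ≤ m k) (n : ℕ) (x : Gm m) : ‖psi m n x‖ = 1 := by
  rw [psi_eq_prod hm (lt_Mseq_succ_self hm n), norm_prod]
  simp [norm_rad]

lemma Dker_Mseq_eq_zero (hm : ∀ k, 2 ≤ m k) {a : ℕ} {x : Gm m} (hx : x ∉ IsetO m a) :
    Dker m (Mseq m a) x = 0 := by
  obtain ⟨b, hb, hxb⟩ : ∃ b < a, x b ≠ 0 := by simpa [IsetO, Iset] using hx
  induction a, (show b + 1 ≤ a from hb) using Nat.le_induction with
  | base => rw [Dker_Mseq_succ hm, sum_rad_pow_eq_zero hxb, zero_mul]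
  | succ a hab ih =>
    rw [Dker_Mseq_succ hm, ih (fun h => hxb (h b hab)) hab, mul_zero]

lemma norm_sum_Ico_psi_le (hm : ∀ k, 2 ≤ m k) (a : ℕ) (x : Gm m) :
    ‖∑ i ∈ Ico (Mseq m a) (Mseq m (a + 1)), psi m i x‖ ≤
      (IsetO m a).indicator (fun _ => (Mseq m (a + 1) : ℝ)) x := by
  by_cases hx : x ∈ IsetO m a
  · rw [Set.indicator_of_mem hx]
    refine (norm_sum_le _ _).trans ?_
    simp [norm_psi hm]
  · rw [Set.indicator_of_notMem hx, sum_Ico_eq_sub _ ((Mseq_strictMono hm).monotone a.le_succ)]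
    have h1 := Dker_Mseq_eq_zero hm hx
    have h2 : Dker m (Mseq m (a + 1)) x = 0 := by rw [Dker_Mseq_succ hm, h1, mul_zero]
    simp only [Dker] at h1 h2
    simp [h1, h2]

/-- Off `I_1`, partial sums whose coefficients are constant on the blocks `[m_0 q, m_0 (q + 1))`
reduce to their last term. -/
lemma Spart_base_mul_add_one (hm : ∀ k, 2 ≤ m k) {c : ℕ → ℂ}
    (hc : ∀ q l, l < m 0 → c (m 0 * q + l) = c (m 0 * q)) (q : ℕ) {x : Gm m} (hx : x 0 ≠ 0) :
    Spart m c (m 0 * q + 1) x = c (m 0 * q) * psi m (m 0 * q) x := by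
  rw [Spart, sum_range_succ, mul_comm (m 0) q, sum_range_mul_eq, sum_eq_zero, zero_add]
  intro l _
  rw [sum_congr rfl (g := fun r => c (m 0 * l) * psi m (m 0 * l) x * rad m 0 x ^ r), ← mul_sum,
    sum_rad_pow_eq_zero hx, mul_zero]
  intro r hr
  rw [hc _ _ (mem_range.1 hr), psi_base_mul_add hm _ (mem_range.1 hr), mul_assoc]

lemma norm_Spart_level_le (hm : ∀ k, 2 ≤ m k) (κ : ℕ → ℂ) (n : ℕ) (x : Gm m) :
    ‖Spart m (fun i => κ (level m i)) (Mseq m n) x‖ ≤ ‖κ 0‖ +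
      ∑ a ∈ range n, ‖κ a‖ * (IsetO m a).indicator (fun _ => (Mseq m (a + 1) : ℝ)) x := by
  induction n with
  | zero => simp [Spart, Mseq, norm_psi hm, level_zero hm]
  | succ n ih =>
    rw [Spart_level_Mseq_succ hm, sum_range_succ, ← add_assoc]
    refine (norm_add_le _ _).trans (add_le_add ih ?_)
    rw [norm_mul]
    exact mul_le_mul_of_nonneg_left (norm_sum_Ico_psi_le hm n x) (norm_nonneg _)

end Characters

section Measure

variable {m : ℕ → ℕ} {μ : Measure (Gm m)}

lemma measurable_apply_filt {n k : ℕ} (h : k < n) :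
    Measurable[filt m n] (fun x : Gm m => x k) := by
  have h1 : Measurable[filt m n, ⊤] (fun (x : Gm m) (j : Fin n) => x j) :=
    comap_measurable _
  have h2 : Measurable[⊤] (fun y : (j : Fin n) → ZMod (m j) => y ⟨k, h⟩) := measurable_from_top
  exact h2.comp h1

lemma measurable_restrict (n : ℕ) :
    Measurable (fun (x : Gm m) (k : Fin n) => x k) :=
  measurable_pi_lambda _ fun k => measurable_pi_apply (k : ℕ)

lemma filt_mono : Monotone (filt m) := by
  rintro n N h s ⟨t, -, rfl⟩
  exact ⟨(fun y (k : Fin n) => y (Fin.castLE h k)) ⁻¹' t, trivial, rfl⟩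

lemma measurableSet_Iset (n : ℕ) (x : Gm m) : MeasurableSet (Iset m n x) := by
  have : Iset m n x = ⋂ k ∈ Set.Iio n, (fun y : Gm m => y k) ⁻¹' {x k} := by
    ext; simp [Iset]
  rw [this]
  exact MeasurableSet.biInter (Set.to_countable _) fun k _ =>
    measurable_pi_apply k (measurableSet_singleton _)

lemma IsHaarGm.isProbabilityMeasure (hμ : IsHaarGm m μ) : IsProbabilityMeasure μ := by
  constructor
  have := hμ 0 0
  simpa [Iset, Mseq] using this

lemma isPiSystem_filt : IsPiSystem {s : Set (Gm m) | ∃ n, MeasurableSet[filt m n] s} := by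
  rintro s ⟨n, hs⟩ t ⟨k, ht⟩ -
  exact ⟨max n k, (filt_mono (le_max_left n k) s hs).inter (filt_mono (le_max_right n k) t ht)⟩

lemma IsHaarGm.measure_ne_zero_coord (hm : ∀ k, 2 ≤ m k) (hμ : IsHaarGm m μ) :
    μ {x | x 0 ≠ 0} ≠ 0 := by
  have := hμ.isProbabilityMeasure
  have hc : {x : Gm m | x 0 ≠ 0} = (Iset m 1 0)ᶜ := by
    ext; simp [Iset]
  rw [hc, prob_compl_eq_one_sub (measurableSet_Iset 1 0), hμ, Mseq_one]
  refine (tsub_pos_of_lt (ENNReal.inv_lt_one.2 ?_)).ne'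
  exact_mod_cast hm 0

variable [∀ k, NeZero (m k)]

lemma filt_le (n : ℕ) : filt m n ≤ (inferInstance : MeasurableSpace (Gm m)) := by
  rintro s ⟨t, -, rfl⟩
  exact measurable_restrict n t.toFinite.measurableSet

lemma measurable_rad_filt {n k : ℕ} (h : k < n) : Measurable[filt m n] (rad m k) := by
  have : rad m k = (fun z : ZMod (m k) => ZMod.stdAddChar z) ∘ fun x : Gm m => x k :=
    funext (rad_eq_stdAddChar k)
  rw [this]
  exact (measurable_of_finite _).comp (measurable_apply_filt h)

lemma measurable_psi_filt (hm : ∀ k, 2 ≤ m k) {n i : ℕ} (h : i < Mseq m n) :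
    Measurable[filt m n] (psi m i) := by
  rw [funext (psi_eq_prod hm h)]
  exact Finset.measurable_prod _ fun k hk => (measurable_rad_filt (mem_range.1 hk)).pow_const _

lemma measurable_psi (hm : ∀ k, 2 ≤ m k) (i : ℕ) : Measurable (psi m i) :=
  (measurable_psi_filt hm (lt_Mseq_succ_self hm i)).mono (filt_le _) le_rfl

lemma measurable_Spart_filt (hm : ∀ k, 2 ≤ m k) (c : ℕ → ℂ) (n : ℕ) :
    Measurable[filt m n] (Spart m c (Mseq m n)) :=
  Finset.measurable_fun_sum _ fun _ hi =>
    (measurable_psi_filt hm (mem_range.1 hi)).const_mul _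

lemma generateFrom_filt :
    (inferInstance : MeasurableSpace (Gm m)) =
      MeasurableSpace.generateFrom {s | ∃ n, MeasurableSet[filt m n] s} := by
  refine le_antisymm (iSup_le fun k => ?_) (MeasurableSpace.generateFrom_le ?_)
  · rintro s ⟨t, ht, rfl⟩
    exact MeasurableSpace.measurableSet_generateFrom
      ⟨k + 1, measurable_apply_filt (Nat.lt_succ_self k) ht⟩
  · rintro s ⟨n, hs⟩
    exact filt_le n s hs

lemma eq_of_Iset_eq {ν : Measure (Gm m)} [IsProbabilityMeasure μ] [IsProbabilityMeasure ν]
    (h : ∀ n x, μ (Iset m n x) = ν (Iset m n x)) : μ = ν := by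
  refine ext_of_generate_finite _ generateFrom_filt isPiSystem_filt ?_ (by simp)
  rintro _ ⟨n, t, -, rfl⟩
  have hr := measurable_restrict (m := m) n
  have ht := t.toFinite.measurableSet
  rw [← Measure.map_apply hr ht, ← Measure.map_apply hr ht]
  congr 1
  refine Measure.ext_of_singleton fun y => ?_
  rw [Measure.map_apply hr (measurableSet_singleton y),
    Measure.map_apply hr (measurableSet_singleton y)]
  have : (fun (x : Gm m) (k : Fin n) => x k) ⁻¹' {y} =
      Iset m n (fun k => if hk : k < n then y ⟨k, hk⟩ else 0) := by
    ext x
    simp only [Set.mem_preimage, Set.mem_singleton_iff, funext_iff, Iset, Set.mem_ofPred_eq]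
    refine ⟨fun h k hk => by simpa [hk] using h ⟨k, hk⟩, fun h k => by simpa using h k k.2⟩
  rw [this, h]

lemma IsHaarGm.isAddRightInvariant (hμ : IsHaarGm m μ) : μ.IsAddRightInvariant := by
  have := hμ.isProbabilityMeasure
  refine ⟨fun e => ?_⟩
  have he : Measurable fun x : Gm m => x + e := measurable_add_const e
  have := Measure.isProbabilityMeasure_map (μ := μ) he.aemeasurable
  refine eq_of_Iset_eq fun n x => ?_
  rw [Measure.map_apply he (measurableSet_Iset n x), hμ]
  have : (fun y : Gm m => y + e) ⁻¹' Iset m n x = Iset m n (x - e) := by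
    ext; simp [Iset, eq_sub_iff_add_eq]
  rw [this, hμ]

lemma IsHaarGm.integral_eq_zero_of_shift (hμ : IsHaarGm m μ) {h : Gm m → ℂ} (e : Gm m) {ω : ℂ}
    (hω : ω ≠ 1) (hh : ∀ x, h (x + e) = ω * h x) : ∫ x, h x ∂μ = 0 := by
  have := hμ.isAddRightInvariant
  have h1 := integral_add_right_eq_self (μ := μ) h e
  simp only [hh, integral_const_mul] at h1
  have h2 : (ω - 1) * ∫ x, h x ∂μ = 0 := by rw [sub_mul, h1]; ring
  exact (mul_eq_zero.1 h2).resolve_left (sub_ne_zero.2 hω)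

lemma psi_add_single (hm : ∀ k, 2 ≤ m k) (i b : ℕ) (x : Gm m) :
    psi m i (x + Pi.single b 1) =
      (ZMod.stdAddChar (1 : ZMod (m b))) ^ digit m i b * psi m i x := by
  have hlt : i < Mseq m (max (i + 1) (b + 1)) :=
    (lt_Mseq_succ_self hm i).trans_le ((Mseq_strictMono hm).monotone (le_max_left _ _))
  have hb : b ∈ range (max (i + 1) (b + 1)) := by simp
  rw [psi_eq_prod hm hlt, psi_eq_prod hm hlt, ← mul_prod_erase _ _ hb,
    ← mul_prod_erase (range (max (i + 1) (b + 1))) (fun k => rad m k x ^ digit m i k) hb]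
  rw [← mul_assoc, ← mul_pow]
  congr 1
  · simp [rad_eq_stdAddChar, AddChar.map_add_eq_mul, mul_comm]
  · refine prod_congr rfl fun k hk => ?_
    simp [rad_eq_stdAddChar, (mem_erase.1 hk).1]

lemma stdAddChar_one_pow_eq (hm : ∀ k, 2 ≤ m k) {b i j : ℕ} :
    (ZMod.stdAddChar (1 : ZMod (m b))) ^ digit m i b =
      (ZMod.stdAddChar (1 : ZMod (m b))) ^ digit m j b ↔ digit m i b = digit m j b := by
  refine ⟨fun h => ?_, fun h => by rw [h]⟩
  rw [← AddChar.map_nsmul_eq_pow, ← AddChar.map_nsmul_eq_pow] at h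
  have := ZMod.injective_stdAddChar h
  simp only [nsmul_eq_mul, mul_one] at this
  have hpos : 0 < m b := by have := hm b; omega
  have hmod : ∀ n, digit m n b % m b = digit m n b := fun n =>
    Nat.mod_eq_of_lt (Nat.mod_lt _ hpos)
  have h' := (ZMod.natCast_eq_natCast_iff' _ _ _).1 this
  rwa [hmod, hmod] at h'

lemma IsHaarGm.setIntegral_psi_eq_zero (hm : ∀ k, 2 ≤ m k) (hμ : IsHaarGm m μ) {n i : ℕ}
    (hi : Mseq m n ≤ i) {s : Set (Gm m)} (hs : MeasurableSet[filt m n] s) :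
    ∫ x in s, psi m i x ∂μ = 0 := by
  rw [← integral_indicator (filt_le n s hs)]
  obtain ⟨b, hb, hd⟩ := exists_digit_ne_zero hm hi
  refine hμ.integral_eq_zero_of_shift (Pi.single b 1)
    (ω := (ZMod.stdAddChar (1 : ZMod (m b))) ^ digit m i b) ?_ fun x => ?_
  · have h0 : digit m 0 b = 0 := by simp [digit]
    have := (stdAddChar_one_pow_eq hm (b := b) (i := i) (j := 0)).not.2 (by rwa [h0])
    rwa [h0, pow_zero] at this
  · obtain ⟨t, -, rfl⟩ := hs
    have hr : (fun k : Fin n => (x + Pi.single b 1 : Gm m) k) = fun k : Fin n => x k := by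
      funext k
      simp [(show (k : ℕ) ≠ b by have := k.2; omega)]
    have hmem : x + Pi.single b 1 ∈ (fun (x : Gm m) (k : Fin n) => x k) ⁻¹' t ↔
        x ∈ (fun (x : Gm m) (k : Fin n) => x k) ⁻¹' t := by
      rw [Set.mem_preimage, hr, Set.mem_preimage]
    by_cases hx : x ∈ (fun (x : Gm m) (k : Fin n) => x k) ⁻¹' t
    · rw [Set.indicator_of_mem (hmem.2 hx), Set.indicator_of_mem hx,
        psi_add_single hm]
    · rw [Set.indicator_of_notMem (hmem.not.2 hx), Set.indicator_of_notMem hx,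
        mul_zero]

lemma IsHaarGm.integral_psi_mul_conj_psi (hm : ∀ k, 2 ≤ m k) (hμ : IsHaarGm m μ) (i j : ℕ) :
    ∫ x, psi m i x * (starRingEnd ℂ) (psi m j x) ∂μ = if i = j then 1 else 0 := by
  have := hμ.isProbabilityMeasure
  split_ifs with hij
  · subst hij
    simp [Complex.mul_conj, Complex.normSq_eq_norm_sq, norm_psi hm]
  · obtain ⟨b, hb⟩ : ∃ b, digit m i b ≠ digit m j b := by
      by_contra! h
      exact hij (eq_of_digit_eq hm h)
    set z : ℂ := ZMod.stdAddChar (1 : ZMod (m b)) with hz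
    have hz1 : z * (starRingEnd ℂ) z = 1 := by
      rw [hz, ZMod.stdAddChar_apply, Complex.mul_conj, Complex.normSq_eq_norm_sq, Circle.norm_coe]
      simp
    refine hμ.integral_eq_zero_of_shift (Pi.single b 1)
      (ω := z ^ digit m i b * (starRingEnd ℂ) (z ^ digit m j b)) ?_ fun x => ?_
    · intro h
      refine hb ((stdAddChar_one_pow_eq hm).1 ?_)
      rw [← hz]
      calc z ^ digit m i b = z ^ digit m i b * (z * (starRingEnd ℂ) z) ^ digit m j b := by
            rw [hz1]; simp
        _ = z ^ digit m j b * (z ^ digit m i b * (starRingEnd ℂ) (z ^ digit m j b)) := by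
            rw [mul_pow, map_pow]; ring
        _ = z ^ digit m j b := by rw [h, mul_one]
    · rw [psi_add_single hm, psi_add_single hm, map_mul]
      ring

lemma integrable_psi (hm : ∀ k, 2 ≤ m k) [IsFiniteMeasure μ] (i : ℕ) : Integrable (psi m i) μ :=
  Integrable.of_bound (measurable_psi hm i).aestronglyMeasurable 1
    (Eventually.of_forall fun x => (norm_psi hm i x).le)

lemma integrable_Spart (hm : ∀ k, 2 ≤ m k) [IsFiniteMeasure μ] (c : ℕ → ℂ) (n : ℕ) :
    Integrable (Spart m c n) μ :=
  integrable_finsetSum _ fun i _ => (integrable_psi hm i).const_mul _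

lemma IsHaarGm.fourierCoefFn_Spart (hm : ∀ k, 2 ≤ m k) (hμ : IsHaarGm m μ) (c : ℕ → ℂ) {n i : ℕ}
    (hi : i < n) : fourierCoefFn m μ (Spart m c n) i = c i := by
  have := hμ.isProbabilityMeasure
  have hint : ∀ k, Integrable (fun x => psi m k x * (starRingEnd ℂ) (psi m i x)) μ := fun k =>
    Integrable.of_bound ((measurable_psi hm k).mul
      (Complex.continuous_conj.measurable.comp (measurable_psi hm i))).aestronglyMeasurable 1
      (Eventually.of_forall fun x => by simp [norm_psi hm])
  simp only [fourierCoefFn, Spart, sum_mul, mul_assoc]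
  rw [integral_finsetSum _ fun k _ => (hint k).const_mul _]
  simp [integral_const_mul, hμ.integral_psi_mul_conj_psi hm, hi]

lemma IsHaarGm.isVMartingale_Spart (hm : ∀ k, 2 ≤ m k) (hμ : IsHaarGm m μ) (c : ℕ → ℂ) :
    IsVMartingale m μ (fun n => Spart m c (Mseq m n)) := by
  have := hμ.isProbabilityMeasure
  refine ⟨fun n => integrable_Spart hm c _, measurable_Spart_filt hm c, fun n N hnN => ?_⟩
  refine (ae_eq_condExp_of_forall_setIntegral_eq (filt_le n) (integrable_Spart hm c _)
    (fun s _ _ => (integrable_Spart hm c _).integrableOn) (fun s hs _ => ?_)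
    (measurable_Spart_filt hm c n).aestronglyMeasurable).symm
  have hint : ∀ i, IntegrableOn (fun x => c i * psi m i x) s μ := fun i =>
    ((integrable_psi hm i).const_mul _).integrableOn
  simp only [Spart]
  rw [integral_finsetSum _ fun i _ => hint i, integral_finsetSum _ fun i _ => hint i,
    ← sum_range_add_sum_Ico _ ((Mseq_strictMono hm).monotone hnN), left_eq_add]
  refine sum_eq_zero fun i hi => ?_
  rw [integral_const_mul, hμ.setIntegral_psi_eq_zero hm (mem_Ico.1 hi).1 hs, mul_zero]

end Measure

section Weights

variable {φ : ℕ → ℝ}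

lemma inv_sub_inv_nonneg (hpos : ∀ n, 0 < φ n) (hmono : Monotone φ) (a : ℕ) :
    0 ≤ (φ a)⁻¹ - (φ (a + 1))⁻¹ :=
  sub_nonneg.2 (inv_anti₀ (hpos a) (hmono a.le_succ))

lemma tsum_inv_sub_inv_lt_top (hpos : ∀ n, 0 < φ n) (hmono : Monotone φ) :
    ∑' a, ENNReal.ofReal ((φ a)⁻¹ - (φ (a + 1))⁻¹) < ⊤ := by
  refine lt_of_le_of_lt (ENNReal.tsum_le_of_sum_range_le (c := ENNReal.ofReal (φ 0)⁻¹)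
    fun n => ?_) ENNReal.ofReal_lt_top
  rw [← ENNReal.ofReal_sum_of_nonneg fun a _ => inv_sub_inv_nonneg hpos hmono a]
  refine ENNReal.ofReal_le_ofReal ?_
  rw [sum_range_sub']
  have := inv_pos.2 (hpos n)
  linarith

lemma tsum_inv_sub_inv_mul_eq_top (hpos : ∀ n, 0 < φ n) (hmono : Monotone φ)
    (htop : Tendsto φ atTop atTop) :
    ∑' a, ENNReal.ofReal (((φ a)⁻¹ - (φ (a + 1))⁻¹) * φ a) = ⊤ := by
  by_contra h
  have hnn : ∀ a, 0 ≤ ((φ a)⁻¹ - (φ (a + 1))⁻¹) * φ a := fun a =>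
    mul_nonneg (inv_sub_inv_nonneg hpos hmono a) (hpos a).le
  have hs := ENNReal.summable_toReal h
  simp only [ENNReal.toReal_ofReal (hnn _)] at hs
  have hlim := hs.hasSum.tendsto_sum_nat
  obtain ⟨N, hN⟩ := Metric.tendsto_atTop.1 hlim (1 / 4) (by norm_num)
  obtain ⟨K, hK, hNK⟩ := ((htop.eventually_ge_atTop (2 * φ N)).and (eventually_ge_atTop N)).exists
  have h1 := hN N le_rfl
  have h2 := hN K hNK
  rw [Real.dist_eq, abs_lt] at h1 h2
  rw [← sum_range_add_sum_Ico _ hNK] at h2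
  have h3 : φ N * ((φ N)⁻¹ - (φ K)⁻¹) ≤
      ∑ a ∈ Ico N K, ((φ a)⁻¹ - (φ (a + 1))⁻¹) * φ a := by
    have htel : (φ N)⁻¹ - (φ K)⁻¹ = ∑ a ∈ Ico N K, ((φ a)⁻¹ - (φ (a + 1))⁻¹) := by
      rw [sum_Ico_eq_sub _ hNK, sum_range_sub', sum_range_sub']
      ring
    rw [htel, mul_sum]
    refine sum_le_sum fun a ha => ?_
    rw [mul_comm]
    exact mul_le_mul_of_nonneg_left (hmono (mem_Ico.1 ha).1) (inv_sub_inv_nonneg hpos hmono a)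
  have h4 : φ N * (φ K)⁻¹ ≤ 1 / 2 := by
    rw [← div_eq_mul_inv, div_le_iff₀ (hpos K)]
    linarith
  rw [mul_sub, mul_inv_cancel₀ (hpos N).ne'] at h3
  linarith

end Weights

section Estimates

variable {m : ℕ → ℕ} [∀ k, NeZero (m k)] {μ : Measure (Gm m)} {p : ℝ} {κ : ℕ → ℝ}

lemma rpow_sum_le_sum_rpow {ι : Type*} (hp0 : 0 < p) (hp1 : p ≤ 1) (s : Finset ι) (g : ι → ℝ≥0∞) :
    (∑ i ∈ s, g i) ^ p ≤ ∑ i ∈ s, g i ^ p :=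
  le_sum_of_subadditive (fun y : ℝ≥0∞ => y ^ p) (by simp [hp0])
    (fun a b => ENNReal.rpow_add_le_add_rpow a b hp0.le hp1) s g

lemma IsHaarGm.memHp_Spart_level (hm : ∀ k, 2 ≤ m k) (hμ : IsHaarGm m μ) (hp0 : 0 < p)
    (hp1 : p ≤ 1) (hκ : ∀ a, 0 ≤ κ a)
    (hsum : ∑' a, ENNReal.ofReal (κ a * Mseq m (a + 1)) ^ p * (Mseq m a : ℝ≥0∞)⁻¹ < ⊤) :
    MemHp m μ p (fun n => Spart m (fun i => (κ (level m i) : ℂ)) (Mseq m n)) := by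
  have := hμ.isProbabilityMeasure
  have hmeas : ∀ a, MeasurableSet (IsetO m a) := fun a => measurableSet_Iset a 0
  set B : ℕ → Gm m → ℝ≥0∞ := fun a =>
    (IsetO m a).indicator fun _ => ENNReal.ofReal (κ a * Mseq m (a + 1)) ^ p with hB
  have hbound : ∀ x, (⨆ n, (‖Spart m (fun i => (κ (level m i) : ℂ)) (Mseq m n) x‖₊ : ℝ≥0∞)) ^ p ≤
      ENNReal.ofReal (κ 0) ^ p + ∑' a, B a x := by
    intro x
    rw [← ENNReal.le_rpow_inv_iff hp0]
    refine iSup_le fun n => ?_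
    rw [ENNReal.le_rpow_inv_iff hp0]
    have h1 := norm_Spart_level_le hm (fun a => (κ a : ℂ)) n x
    simp only [Complex.norm_real, Real.norm_of_nonneg (hκ _)] at h1
    have hnn : ∀ a, 0 ≤ κ a * (IsetO m a).indicator (fun _ => (Mseq m (a + 1) : ℝ)) x := fun a =>
      mul_nonneg (hκ a) (Set.indicator_nonneg (fun _ _ => Nat.cast_nonneg _) x)
    have h2 := ENNReal.ofReal_le_ofReal h1
    rw [ENNReal.ofReal_add (hκ 0) (sum_nonneg fun a _ => hnn a),
      ENNReal.ofReal_sum_of_nonneg fun a _ => hnn a, ofReal_norm] at h2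
    refine (ENNReal.rpow_le_rpow h2 hp0.le).trans
      ((ENNReal.rpow_add_le_add_rpow _ _ hp0.le hp1).trans ?_)
    gcongr
    refine (rpow_sum_le_sum_rpow hp0 hp1 _ _).trans (le_trans (le_of_eq ?_)
      (ENNReal.sum_le_tsum (range n)))
    refine sum_congr rfl fun a _ => ?_
    by_cases hx : x ∈ IsetO m a
    · simp [hB, hx]
    · simp [hB, hx, hp0]
  refine (lintegral_mono hbound).trans_lt ?_
  rw [lintegral_add_left measurable_const, lintegral_tsum fun a =>
    (measurable_const.indicator (hmeas a)).aemeasurable]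
  simp only [lintegral_const, measure_univ, mul_one]
  refine ENNReal.add_lt_top.2 ⟨ENNReal.rpow_lt_top_of_nonneg hp0.le ENNReal.ofReal_ne_top, ?_⟩
  convert hsum using 3 with a
  rw [lintegral_indicator_const (hmeas a), IsetO, hμ]

lemma wLp_Spart_level_ge (hm : ∀ k, 2 ≤ m k) (hp0 : 0 < p) (hκ : ∀ a, 0 ≤ κ a) (q : ℕ) :
    ENNReal.ofReal ((κ (level m (m 0 * q)) / 2) ^ p) * μ {x | x 0 ≠ 0} ≤
      wLp m μ p (Spart m (fun i => (κ (level m i) : ℂ)) (m 0 * q + 1)) ^ p := by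
  rcases (hκ (level m (m 0 * q))).eq_or_lt with h0 | hpos
  · simp [← h0, hp0.ne']
  · have hhalf := half_pos hpos
    rw [← ENNReal.ofReal_rpow_of_pos hhalf, ← ENNReal.rpow_inv_le_iff hp0,
      ENNReal.mul_rpow_of_nonneg _ _ (inv_nonneg.2 hp0.le), ENNReal.rpow_rpow_inv hp0.ne']
    refine le_trans ?_ (le_iSup₂ (κ (level m (m 0 * q)) / 2) hhalf)
    rw [one_div]
    gcongr with x
    intro hx
    rw [Spart_base_mul_add_one (c := fun i => (κ (level m i) : ℂ)) hm
      (fun q l hl => by simp only [level_base_mul_add q hl]) q hx, norm_mul, norm_psi hm, mul_one,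
      Complex.norm_real,
      Real.norm_of_nonneg hpos.le]
    exact half_lt_self hpos

lemma sum_Ico_wLp_ge (hm : ∀ k, 2 ≤ m k) (hp0 : 0 < p) (hp1 : p < 1)
    {Φ : ℕ → ℝ} (hΦmono : Monotone Φ) (hκ : ∀ a, 0 ≤ κ a) (a : ℕ) :
    μ {x | x 0 ≠ 0} * ENNReal.ofReal
        (κ (a + 1) ^ p * (Mseq m (a + 1) : ℝ) ^ (p - 1) * Φ (Mseq m (a + 1)) / (4 * m 0)) ≤
      ∑ k ∈ Ico (Mseq m (a + 1)) (Mseq m (a + 2)),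
        wLp m μ p (Spart m (fun i => (κ (level m i) : ℂ)) (k + 1)) ^ p * ENNReal.ofReal (Φ (k + 1)) /
          ENNReal.ofReal ((k + 1 : ℝ) ^ (2 - p)) := by
  obtain ⟨N, hN⟩ := base_dvd_Mseq_succ (m := m) a
  have hM := Mseq_pos hm (a + 1)
  have hm0 : 0 < m 0 := by have := hm 0; omega
  have h2M := two_mul_Mseq_le hm (a + 1)
  set M := Mseq m (a + 1) with hMdef
  have hinj : Function.Injective fun q => m 0 * q := fun _ _ h => Nat.eq_of_mul_eq_mul_left hm0 h
  have hlt : ∀ q ∈ Ico N (2 * N), M ≤ m 0 * q ∧ m 0 * q < 2 * M := fun q hq => by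
    rw [mem_Ico] at hq
    rw [hN, ← mul_assoc, mul_comm 2, mul_assoc]
    exact ⟨Nat.mul_le_mul_left _ hq.1, Nat.mul_lt_mul_of_pos_left hq.2 hm0⟩
  have hsub : (Ico N (2 * N)).image (fun q => m 0 * q) ⊆ Ico M (Mseq m (a + 2)) := by
    intro k hk
    obtain ⟨q, hq, rfl⟩ := mem_image.1 hk
    have := hlt q hq
    exact mem_Ico.2 ⟨this.1, this.2.trans_le h2M⟩
  refine le_trans ?_ (sum_le_sum_of_subset hsub)
  rw [sum_image hinj.injOn]
  set R : ℝ := (κ (a + 1) / 2) ^ p * Φ M / (2 * M : ℝ) ^ (2 - p) with hR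
  have hMR : (0 : ℝ) < M := Nat.cast_pos.2 hM
  have hterm : ∀ q ∈ Ico N (2 * N), μ {x | x 0 ≠ 0} * ENNReal.ofReal R ≤
      wLp m μ p (Spart m (fun i => (κ (level m i) : ℂ)) (m 0 * q + 1)) ^ p *
        ENNReal.ofReal (Φ (m 0 * q + 1)) /
          ENNReal.ofReal (((m 0 * q : ℕ) + 1 : ℝ) ^ (2 - p)) := by
    intro q hq
    obtain ⟨h1, h2⟩ := hlt q hq
    have hlev : level m (m 0 * q) = a + 1 := level_eq hm h1 (h2.trans_le h2M)
    have hw := wLp_Spart_level_ge (μ := μ) hm hp0 hκ q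
    rw [hlev] at hw
    have hκ2 : 0 ≤ (κ (a + 1) / 2) ^ p := Real.rpow_nonneg (by have := hκ (a + 1); linarith) _
    rw [hR, ENNReal.ofReal_div_of_pos (by positivity), ENNReal.ofReal_mul hκ2, ← mul_div_assoc,
      ← mul_assoc, mul_comm (μ _)]
    have hle : ((m 0 * q : ℕ) + 1 : ℝ) ≤ 2 * M := by exact_mod_cast h2
    have hp2 : 0 ≤ 2 - p := by linarith
    gcongr
    exact hΦmono (by omega)
  refine le_trans (le_of_eq ?_) (card_nsmul_le_sum _ _ _ hterm)
  rw [Nat.card_Ico, nsmul_eq_mul, mul_left_comm, ← ENNReal.ofReal_natCast,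
    ← ENNReal.ofReal_mul (Nat.cast_nonneg _)]
  congr 2
  have hNN : 2 * N - N = N := by omega
  have hm0R : (0 : ℝ) < m 0 := Nat.cast_pos.2 hm0
  have hMN : (M : ℝ) = m 0 * N := by rw [hN]; push_cast; ring
  have hNeq : (N : ℝ) = M / m 0 := by rw [hMN]; field_simp
  have e1 : (2 : ℝ) ^ (2 - p) * 2 ^ p = 4 := by
    rw [← Real.rpow_add two_pos]; norm_num
  have e2 : (M : ℝ) ^ (p - 1) * (M : ℝ) ^ (2 - p) = M := by
    rw [← Real.rpow_add hMR]; norm_num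
  rw [hNN, hR, hNeq, Real.div_rpow (hκ _) two_pos.le, Real.mul_rpow two_pos.le hMR.le]
  have p1 : (0 : ℝ) < 2 ^ p := by positivity
  have p2 : (0 : ℝ) < 2 ^ (2 - p) := by positivity
  have p3 : (0 : ℝ) < (M : ℝ) ^ (2 - p) := by positivity
  rw [← e1, ← mul_div_assoc, div_eq_div_iff (by positivity) (by positivity)]
  calc _ = (κ (a + 1) ^ p * Φ M * 2 ^ (2 - p)) * ((M : ℝ) ^ (p - 1) * (M : ℝ) ^ (2 - p)) := by ring
    _ = _ := by rw [e2]; field_simp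

end Estimates

theorem statement2 (m : ℕ → ℕ) (hm : ∀ k, 2 ≤ m k)
    (MM : ℕ) (hMM : IsLUB (Set.range m) MM)
    (μ : Measure (Gm m)) (hμ : IsHaarGm m μ)
    (p : ℝ) (hp0 : 0 < p) (hp1 : p < 1)
    (Φ : ℕ → ℝ) (hΦpos : ∀ n, 0 < Φ n) (hΦmono : Monotone Φ)
    (hΦtop : Tendsto Φ atTop atTop) :
    ∃ (f : ℕ → Gm m → ℂ) (c : ℕ → ℂ),
      IsVMartingale m μ f ∧ MemHp m μ p f ∧
      (∀ i, Tendsto (fun k => fourierCoefFn m μ (f k) i) atTop (nhds (c i))) ∧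
      ∑' k : ℕ, wLp m μ p (Spart m c (k + 1)) ^ p * ENNReal.ofReal (Φ (k + 1)) /
        ENNReal.ofReal ((k + 1 : ℝ) ^ (2 - p)) = ⊤ := by
  have : ∀ k, NeZero (m k) := fun k => ⟨by have := hm k; omega⟩
  have hMmono := Mseq_strictMono hm
  have hMpos : ∀ a, (0 : ℝ) < Mseq m a := fun a => Nat.cast_pos.2 (Mseq_pos hm a)
  set φ : ℕ → ℝ := fun a => Φ (Mseq m a) with hφ
  have hφpos : ∀ a, 0 < φ a := fun a => hΦpos _
  have hφmono : Monotone φ := hΦmono.comp hMmono.monotone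
  have hφtop : Tendsto φ atTop atTop := hΦtop.comp hMmono.tendsto_atTop
  set w : ℕ → ℝ := fun a => (φ a)⁻¹ - (φ (a + 1))⁻¹ with hw
  have hw0 : ∀ a, 0 ≤ w a := inv_sub_inv_nonneg hφpos hφmono
  set κ : ℕ → ℝ := fun a => (w a * (Mseq m a : ℝ) ^ (1 - p)) ^ p⁻¹ with hκdef
  have hbase : ∀ a, 0 ≤ w a * (Mseq m a : ℝ) ^ (1 - p) := fun a =>
    mul_nonneg (hw0 a) (Real.rpow_nonneg (hMpos a).le _)
  have hκ : ∀ a, 0 ≤ κ a := fun a => Real.rpow_nonneg (hbase a) _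
  have hκp : ∀ a, κ a ^ p = w a * (Mseq m a : ℝ) ^ (1 - p) := fun a =>
    Real.rpow_inv_rpow (hbase a) hp0.ne'
  refine ⟨fun n => Spart m (fun i => (κ (level m i) : ℂ)) (Mseq m n),
    fun i => (κ (level m i) : ℂ), hμ.isVMartingale_Spart hm _,
    hμ.memHp_Spart_level hm hp0 hp1.le hκ ?_, fun i => ?_, ?_⟩
  · have hterm : ∀ a, ENNReal.ofReal (κ a * Mseq m (a + 1)) ^ p * (Mseq m a : ℝ≥0∞)⁻¹ ≤
        ENNReal.ofReal ((MM : ℝ) ^ p) * ENNReal.ofReal (w a) := fun a => by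
      have hle : (Mseq m (a + 1) : ℝ) ≤ MM * Mseq m a := by
        exact_mod_cast Nat.mul_le_mul_right _ (hMM.1 ⟨a, rfl⟩)
      rw [ENNReal.ofReal_rpow_of_nonneg (mul_nonneg (hκ a) (Nat.cast_nonneg _)) hp0.le,
        ← ENNReal.ofReal_natCast, ← ENNReal.ofReal_inv_of_pos (hMpos a),
        ← ENNReal.ofReal_mul' (inv_nonneg.2 (hMpos a).le), ← ENNReal.ofReal_mul (by positivity)]
      refine ENNReal.ofReal_le_ofReal ?_
      calc (κ a * Mseq m (a + 1)) ^ p * (Mseq m a : ℝ)⁻¹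
          ≤ (κ a * (MM * Mseq m a)) ^ p * (Mseq m a : ℝ)⁻¹ := by
            have := hκ a
            have := hMpos a
            gcongr
        _ = (MM : ℝ) ^ p * w a *
            ((Mseq m a : ℝ) ^ (1 - p) * (Mseq m a : ℝ) ^ p * (Mseq m a : ℝ)⁻¹) := by
            rw [Real.mul_rpow (hκ a) (by positivity),
              Real.mul_rpow (Nat.cast_nonneg _) (Nat.cast_nonneg _), hκp]
            ring
        _ = (MM : ℝ) ^ p * w a := by
            rw [← Real.rpow_add (hMpos a), sub_add_cancel, Real.rpow_one,
              mul_inv_cancel₀ (hMpos a).ne', mul_one]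
    refine (ENNReal.tsum_le_tsum hterm).trans_lt ?_
    rw [ENNReal.tsum_mul_left]
    exact ENNReal.mul_lt_top ENNReal.ofReal_lt_top (tsum_inv_sub_inv_lt_top hφpos hφmono)
  · refine tendsto_const_nhds.congr' ?_
    filter_upwards [hMmono.tendsto_atTop.eventually_gt_atTop i] with n hn
    exact (hμ.fourierCoefFn_Spart hm (fun i => (κ (level m i) : ℂ)) hn).symm
  · have hm0 : (0 : ℝ) < m 0 := by have := hm 0; exact_mod_cast (by omega : 0 < m 0)
    have hdiv := tsum_inv_sub_inv_mul_eq_top (fun a => hφpos (a + 1))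
      (hφmono.comp fun _ _ h => Nat.succ_le_succ h) (hφtop.comp (tendsto_add_atTop_nat 1))
    refine top_le_iff.1 (le_trans (le_of_eq ?_)
      (tsum_le_tsum_of_le_sum_Ico hm (sum_Ico_wLp_ge hm hp0 hp1 hΦmono hκ)))
    have hg : ∀ a, ENNReal.ofReal (κ (a + 1) ^ p * (Mseq m (a + 1) : ℝ) ^ (p - 1) *
        Φ (Mseq m (a + 1)) / (4 * m 0)) =
        ENNReal.ofReal ((4 * m 0 : ℝ)⁻¹) * ENNReal.ofReal (w (a + 1) * φ (a + 1)) := fun a => by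
      have e : (Mseq m (a + 1) : ℝ) ^ (1 - p) * (Mseq m (a + 1) : ℝ) ^ (p - 1) = 1 := by
        rw [← Real.rpow_add (hMpos _)]
        simp
      rw [← ENNReal.ofReal_mul (by positivity), hκp, mul_assoc (w _), e, mul_one,
        div_eq_mul_inv, mul_comm]
    simp only [hg]
    rw [ENNReal.tsum_mul_left, ENNReal.tsum_mul_left]
    rw [show ∑' a, ENNReal.ofReal (w (a + 1) * φ (a + 1)) = ⊤ from hdiv,
      ENNReal.mul_top (ENNReal.ofReal_pos.2 (by positivity)).ne', ENNReal.mul_top (hμ.measure_ne_zero_coord hm)]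

end VilenkinPaper
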